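/- Define derivations δ_{n,m} (n ≥ 0, m ≥ 1) of the free algebra C<X,Y> by δ_{n,m}(X) = [c_{n,m}, X], δ_{n,m}(Y) = 0, where c_{n,m} is the sum of all words with n X's and m Y's. Then for all (n,m) and (n',m'), the derivations commute: [δ_{n,m}, δ_{n',m'}] = 0 as derivations of C<X,Y>. (A verifiable special case: [δ_{0,1}, δ_{1,1}] = 0.) -/

import Mathlib

/-- The word `f : Fin k → Fin 2` as a (noncommutative) monomial in the free algebra
`ℂ⟨X,Y⟩`, where `0 ↦ X`, `1 ↦ Y`. -/
noncomputable def word {k : ℕ} (f : Fin k → Fin 2) : FreeAlgebra ℂ (Fin 2) :=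
  (List.ofFn fun i => FreeAlgebra.ι ℂ (f i)).prod

/-- `c n m` : the sum of all words with exactly `n` letters `X` and `m` letters `Y`. -/
noncomputable def c (n m : ℕ) : FreeAlgebra ℂ (Fin 2) :=
  ∑ f ∈ Finset.univ.filter
      (fun f : Fin (n + m) → Fin 2 => (List.ofFn f).count 0 = n), word f

/-- A `ℂ`-linear endomorphism of `ℂ⟨X,Y⟩` is a derivation if it satisfies the
Leibniz rule. -/
def IsDerivation (d : FreeAlgebra ℂ (Fin 2) →ₗ[ℂ] FreeAlgebra ℂ (Fin 2)) : Prop :=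
  ∀ a b : FreeAlgebra ℂ (Fin 2), d (a * b) = d a * b + a * d b

/-- The sum of all words of length `k` with exactly `n` letters `X`. -/
noncomputable def wordSum (k n : ℕ) : FreeAlgebra ℂ (Fin 2) :=
  ∑ f ∈ Finset.univ.filter (fun f : Fin k → Fin 2 => (List.ofFn f).count 0 = n), word f

theorem c_eq_wordSum (n m : ℕ) : c n m = wordSum (n + m) n := rfl

theorem word_cons {k : ℕ} (a : Fin 2) (f : Fin k → Fin 2) :
    word (Fin.cons a f : Fin (k + 1) → Fin 2) = FreeAlgebra.ι ℂ a * word f := by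
  simp [word, List.ofFn_succ]

theorem wordSum_eq_zero {k n : ℕ} (h : k < n) : wordSum k n = 0 := by
  refine Finset.sum_eq_zero fun f hf => ?_
  have h1 := (Finset.mem_filter.1 hf).2
  have h2 := List.count_le_length (a := (0 : Fin 2)) (l := List.ofFn f)
  rw [List.length_ofFn] at h2
  omega

theorem wordSum_succ (k n : ℕ) :
    wordSum (k + 1) n =
      (∑ f : Fin k → Fin 2, if (List.ofFn f).count 0 + 1 = n then
        FreeAlgebra.ι ℂ 0 * word f else 0) + FreeAlgebra.ι ℂ 1 * wordSum k n := by
  rw [wordSum, Finset.sum_filter, ← (Fin.consEquiv fun _ : Fin (k + 1) => Fin 2).sum_comp,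
    Fintype.sum_prod_type, Fin.sum_univ_two, wordSum, Finset.sum_filter, Finset.mul_sum]
  simp [Fin.consEquiv, word_cons]

theorem wordSum_succ_zero (k : ℕ) :
    wordSum (k + 1) 0 = FreeAlgebra.ι ℂ 1 * wordSum k 0 := by
  simp [wordSum_succ]

theorem wordSum_succ_succ (k n : ℕ) :
    wordSum (k + 1) (n + 1) =
      FreeAlgebra.ι ℂ 0 * wordSum k n + FreeAlgebra.ι ℂ 1 * wordSum k (n + 1) := by
  rw [wordSum_succ]
  congr 1
  rw [wordSum, Finset.sum_filter, Finset.mul_sum]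
  simp

theorem c_zero_zero : c 0 0 = 1 := by
  simp [c, word]

theorem c_zero_succ (m : ℕ) : c 0 (m + 1) = FreeAlgebra.ι ℂ 1 * c 0 m := by
  simp only [c_eq_wordSum, ← add_assoc, wordSum_succ_zero]

theorem c_succ_zero (n : ℕ) : c (n + 1) 0 = FreeAlgebra.ι ℂ 0 * c n 0 := by
  simp only [c_eq_wordSum, add_zero, wordSum_succ_succ, wordSum_eq_zero n.lt_succ_self, mul_zero]

theorem c_succ_succ (n m : ℕ) :
    c (n + 1) (m + 1) =
      FreeAlgebra.ι ℂ 0 * c n (m + 1) + FreeAlgebra.ι ℂ 1 * c (n + 1) m := by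
  simp only [c_eq_wordSum, ← add_assoc, wordSum_succ_succ]
  rw [show n + 1 + m = n + m + 1 by ring]

/-- Resolvent identity behind the commutation: `C` and `C'` are the inverses of
`1 - xX - yY` and `1 - x'X - y'Y`, with `x`, `y`, `x'`, `y'` central scalars. -/
theorem resolvent_identity {S R : Type*} [CommRing S] [Ring R] [Algebra S R]
    {X Y C C' : R} {x y x' y' : S} (hne : ∀ r : R, (x' - x) • r = 0 → r = 0)
    (hl : C = 1 + x • (X * C) + y • (Y * C)) (hr : C = 1 + x • (C * X) + y • (C * Y))
    (hl' : C' = 1 + x' • (X * C') + y' • (Y * C'))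
    (hr' : C' = 1 + x' • (C' * X) + y' • (C' * Y)) :
    x' • (C' * (C * X - X * C) * C') - x • (C * (C' * X - X * C') * C) =
      C * C' - C' * C := by
  have h1 : (x' - x) • (C * C') =
      x' • C' - x • C + (x' * y - x * y') • (C * Y * C') := by
    have a1 := congrArg (C * ·) hl'
    have a2 := congrArg (· * C') hr
    simp only [mul_add, add_mul, mul_one, one_mul, mul_smul_comm, smul_mul_assoc,
      ← mul_assoc] at a1 a2
    linear_combination (norm := module) x' • a2 - x • a1
  have h2 : (x' - x) • (C' * C) =
      x' • C' - x • C + (x' * y - x * y') • (C' * Y * C) := by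
    have a1 := congrArg (C' * ·) hl
    have a2 := congrArg (· * C) hr'
    simp only [mul_add, add_mul, mul_one, one_mul, mul_smul_comm, smul_mul_assoc,
      ← mul_assoc] at a1 a2
    linear_combination (norm := module) x' • a1 - x • a2
  have h3 : C * C' - C' * C + y • (C * C' * Y * C - C * Y * C' * C)
      - y' • (C' * C * Y * C' - C' * Y * C * C') = 0 := by
    apply hne
    have a1 := congrArg (· * (Y * C)) h1
    have a2 := congrArg (C * Y * ·) h2
    have a3 := congrArg (· * (Y * C')) h2
    have a4 := congrArg (C' * Y * ·) h1
    simp only [mul_add, add_mul, mul_sub, sub_mul, mul_smul_comm, smul_mul_assoc,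
      ← mul_assoc] at a1 a2 a3 a4
    linear_combination (norm := module) h1 - h2 + y • a1 - y • a2 - y' • a3 + y' • a4
  have b1 := congrArg (C' * C * ·) hl'
  have b2 := congrArg (· * (C * C')) hr'
  have b3 := congrArg (C * C' * ·) hl
  have b4 := congrArg (· * (C' * C)) hr
  simp only [mul_add, add_mul, mul_sub, sub_mul, mul_one, one_mul, mul_smul_comm,
    smul_mul_assoc, ← mul_assoc] at b1 b2 b3 b4 ⊢
  linear_combination (norm := module) h3 - b1 + b2 + b3 - b4

theorem smul_resolvent_mul {S R : Type*} [CommRing S] [Ring R] [Algebra S R]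
    {X Y C : R} {x y : S} (hl : C = 1 + x • (X * C) + y • (Y * C)) (u D : R) :
    x • (C * u * D) = x • (u * D) + x • (X * (x • (C * u * D))) +
      y • (Y * (x • (C * u * D))) := by
  have h := congrArg (· * u * D) hl
  simp only [add_mul, one_mul, smul_mul_assoc, mul_smul_comm, ← mul_assoc] at h ⊢
  linear_combination (norm := module) x • h

theorem IsDerivation.map_one {d : FreeAlgebra ℂ (Fin 2) →ₗ[ℂ] FreeAlgebra ℂ (Fin 2)}
    (hd : IsDerivation d) : d 1 = 0 := by
  simpa using hd 1 1

theorem IsDerivation.map_algebraMap {d : FreeAlgebra ℂ (Fin 2) →ₗ[ℂ] FreeAlgebra ℂ (Fin 2)}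
    (hd : IsDerivation d) (r : ℂ) : d (algebraMap ℂ _ r) = 0 := by
  rw [Algebra.algebraMap_eq_smul_one, map_smul, hd.map_one, smul_zero]

/-- Two derivations commute as soon as they commute on the generators. -/
theorem IsDerivation.comp_comm {d e : FreeAlgebra ℂ (Fin 2) →ₗ[ℂ] FreeAlgebra ℂ (Fin 2)}
    (hd : IsDerivation d) (he : IsDerivation e)
    (h : ∀ i, d (e (FreeAlgebra.ι ℂ i)) = e (d (FreeAlgebra.ι ℂ i))) :
    d.comp e = e.comp d := by
  ext a
  simp only [LinearMap.comp_apply]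
  induction a using FreeAlgebra.induction with
  | grade0 r => simp [hd.map_algebraMap, he.map_algebraMap]
  | grade1 i => exact h i
  | mul a b ha hb =>
    rw [hd, he, map_add, map_add, hd, hd, he, he, ha, hb]
    abel
  | add a b ha hb => simp only [map_add, ha, hb]

/-- The recursion determining the values on the `c n m` of the derivation
`X ↦ u`, `Y ↦ 0`. -/
theorem IsDerivation.apply_c {d : FreeAlgebra ℂ (Fin 2) →ₗ[ℂ] FreeAlgebra ℂ (Fin 2)}
    (hd : IsDerivation d) {u : FreeAlgebra ℂ (Fin 2)} (hX : d (FreeAlgebra.ι ℂ 0) = u)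
    (hY : d (FreeAlgebra.ι ℂ 1) = 0) {g : ℕ → ℕ → FreeAlgebra ℂ (Fin 2)}
    (h00 : g 0 0 = 0) (h01 : ∀ m, g 0 (m + 1) = FreeAlgebra.ι ℂ 1 * g 0 m)
    (h10 : ∀ n, g (n + 1) 0 = u * c n 0 + FreeAlgebra.ι ℂ 0 * g n 0)
    (h11 : ∀ n m, g (n + 1) (m + 1) = u * c n (m + 1) +
      FreeAlgebra.ι ℂ 0 * g n (m + 1) + FreeAlgebra.ι ℂ 1 * g (n + 1) m) (n m : ℕ) :
    d (c n m) = g n m := by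
  induction n generalizing m with
  | zero =>
    induction m with
    | zero => rw [c_zero_zero, hd.map_one, h00]
    | succ m ih => rw [c_zero_succ, hd, hY, ih, h01, zero_mul, zero_add]
  | succ n ihn =>
    induction m with
    | zero => rw [c_succ_zero, hd, hX, ihn, h10]
    | succ m ihm =>
      rw [c_succ_succ, map_add, hd, hd, hX, hY, ihn, ihm, h11, zero_mul, zero_add]

section GeneratingSeries

open PowerSeries

/-- The generating series `∑ c n m xⁿ yᵐ`. -/
noncomputable def cSeries : (FreeAlgebra ℂ (Fin 2))⟦X⟧⟦X⟧ :=
  mk fun n => mk fun m => c n m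

theorem cSeries_eq_left : cSeries = 1 + X * (C (C (FreeAlgebra.ι ℂ 0)) * cSeries) +
    C X * (C (C (FreeAlgebra.ι ℂ 1)) * cSeries) := by
  ext n m
  rcases n with _ | n <;> rcases m with _ | m <;>
    simp [cSeries, coeff_succ_X_mul, coeff_C_mul, coeff_one, -coeff_zero_eq_constantCoeff,
      coeff_zero_X_mul, c_zero_zero, c_zero_succ, c_succ_zero, c_succ_succ]

theorem cSeries_eq_right : cSeries = 1 + X * (cSeries * C (C (FreeAlgebra.ι ℂ 0))) +
    C X * (cSeries * C (C (FreeAlgebra.ι ℂ 1))) := by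
  have h : (1 - X * C (C (FreeAlgebra.ι ℂ 0)) - C X * C (C (FreeAlgebra.ι ℂ 1))) *
      cSeries = 1 := by
    rw [sub_mul, sub_mul, one_mul, mul_assoc, mul_assoc]
    nth_rewrite 1 [cSeries_eq_left]
    abel
  have hc : Commute cSeries (C X) := by
    ext n m
    simp [coeff_mul_C, coeff_C_mul, (commute_X _).eq]
  rw [mul_eq_one_comm, mul_sub, mul_sub, mul_one, ← mul_assoc, ← mul_assoc,
    (commute_X cSeries).eq, hc.eq, mul_assoc, mul_assoc, sub_sub, sub_eq_iff_eq_add] at h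
  rw [add_assoc]
  exact h

/-- `cSeries` in the inner pair of variables, as a series in two pairs of variables. -/
noncomputable def cInner : (FreeAlgebra ℂ (Fin 2))⟦X⟧⟦X⟧⟦X⟧⟦X⟧ := C (C cSeries)

/-- `cSeries` in the outer pair of variables, as a series in two pairs of variables. -/
noncomputable def cOuter : (FreeAlgebra ℂ (Fin 2))⟦X⟧⟦X⟧⟦X⟧⟦X⟧ :=
  map (map (C.comp C)) cSeries

/-- The coefficient of a series in two pairs of variables, inner pair first. -/
noncomputable def coeffs (n m n' m' : ℕ) (φ : (FreeAlgebra ℂ (Fin 2))⟦X⟧⟦X⟧⟦X⟧⟦X⟧) :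
    FreeAlgebra ℂ (Fin 2) :=
  coeff m (coeff n (coeff m' (coeff n' φ)))

/-- A constant series in two pairs of variables. -/
noncomputable def const (a : FreeAlgebra ℂ (Fin 2)) :
    (FreeAlgebra ℂ (Fin 2))⟦X⟧⟦X⟧⟦X⟧⟦X⟧ := C (C (C (C a)))

theorem coeffs_add (n m n' m' : ℕ) (φ ψ : (FreeAlgebra ℂ (Fin 2))⟦X⟧⟦X⟧⟦X⟧⟦X⟧) :
    coeffs n m n' m' (φ + ψ) = coeffs n m n' m' φ + coeffs n m n' m' ψ := by
  simp [coeffs]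

theorem coeffs_sub (n m n' m' : ℕ) (φ ψ : (FreeAlgebra ℂ (Fin 2))⟦X⟧⟦X⟧⟦X⟧⟦X⟧) :
    coeffs n m n' m' (φ - ψ) = coeffs n m n' m' φ - coeffs n m n' m' ψ := by
  simp [coeffs]

theorem coeffs_const_mul (n m n' m' : ℕ) (a : FreeAlgebra ℂ (Fin 2))
    (φ : (FreeAlgebra ℂ (Fin 2))⟦X⟧⟦X⟧⟦X⟧⟦X⟧) :
    coeffs n m n' m' (const a * φ) = a * coeffs n m n' m' φ := by
  simp [coeffs, const, coeff_C_mul]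

theorem coeffs_commutator_cInner_mul_cOuter (n m n' m' : ℕ) (a : FreeAlgebra ℂ (Fin 2)) :
    coeffs n m n' m' ((cInner * const a - const a * cInner) * cOuter) =
      (c n m * a - a * c n m) * c n' m' := by
  have h : cInner * const a - const a * cInner =
      C (C (cSeries * C (C a) - C (C a) * cSeries)) := by
    simp [cInner, const]
  simp only [h, coeffs, cOuter, cSeries, coeff_C_mul, coeff_mul_C, coeff_map, coeff_mk,
    RingHom.comp_apply, map_sub (coeff _)]

theorem coeffs_commutator_cOuter_mul_cInner (n m n' m' : ℕ) (a : FreeAlgebra ℂ (Fin 2)) :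
    coeffs n m n' m' ((cOuter * const a - const a * cOuter) * cInner) =
      (c n' m' * a - a * c n' m') * c n m := by
  have h : coeff m' (coeff n' (cOuter * const a - const a * cOuter)) =
      C (C (c n' m' * a - a * c n' m')) := by
    simp [cOuter, const, cSeries, coeff_C_mul, coeff_mul_C]
  simp only [coeffs, cInner, coeff_mul_C, h, coeff_C_mul, cSeries, coeff_mk]

theorem coeffs_cInner_mul_cOuter (n m n' m' : ℕ) :
    coeffs n m n' m' (cInner * cOuter) = c n m * c n' m' := by
  simp [coeffs, cOuter, cInner, cSeries, coeff_C_mul, coeff_mul_C]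

theorem coeffs_cOuter_mul_cInner (n m n' m' : ℕ) :
    coeffs n m n' m' (cOuter * cInner) = c n' m' * c n m := by
  simp [coeffs, cOuter, cInner, cSeries, coeff_C_mul, coeff_mul_C]

theorem apply_c_outer (n m : ℕ)
    {d : FreeAlgebra ℂ (Fin 2) →ₗ[ℂ] FreeAlgebra ℂ (Fin 2)} (hd : IsDerivation d)
    (hdX : d (FreeAlgebra.ι ℂ 0) =
      c n m * FreeAlgebra.ι ℂ 0 - FreeAlgebra.ι ℂ 0 * c n m)
    (hdY : d (FreeAlgebra.ι ℂ 1) = 0) {G : (FreeAlgebra ℂ (Fin 2))⟦X⟧⟦X⟧⟦X⟧⟦X⟧}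
    (hG : G = X * ((cInner * const (FreeAlgebra.ι ℂ 0) - const (FreeAlgebra.ι ℂ 0) * cInner) *
        cOuter) + X * (const (FreeAlgebra.ι ℂ 0) * G) +
        C X * (const (FreeAlgebra.ι ℂ 1) * G))
    (n' m' : ℕ) : d (c n' m') = coeffs n m n' m' G := by
  have hXs : ∀ (k l : ℕ) φ, coeffs n m (k + 1) l (X * φ) = coeffs n m k l φ := by
    simp [coeffs, coeff_succ_X_mul]
  have hX0 : ∀ (l : ℕ) φ, coeffs n m 0 l (X * φ) = 0 := by
    simp [coeffs]
  have hYs : ∀ (k l : ℕ) φ, coeffs n m k (l + 1) (C X * φ) = coeffs n m k l φ := by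
    simp [coeffs, coeff_succ_X_mul, coeff_C_mul]
  have hY0 : ∀ (k : ℕ) φ, coeffs n m k 0 (C X * φ) = 0 := by
    simp [coeffs, coeff_C_mul]
  refine hd.apply_c hdX hdY (g := fun k l => coeffs n m k l G) ?_ ?_ ?_ ?_ n' m' <;> intros <;>
    conv_lhs => rw [hG]
  all_goals simp only [coeffs_add, hXs, hX0, hYs, hY0, coeffs_const_mul,
    coeffs_commutator_cInner_mul_cOuter, add_zero, zero_add]

theorem apply_c_inner (n' m' : ℕ)
    {e : FreeAlgebra ℂ (Fin 2) →ₗ[ℂ] FreeAlgebra ℂ (Fin 2)} (he : IsDerivation e)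
    (heX : e (FreeAlgebra.ι ℂ 0) =
      c n' m' * FreeAlgebra.ι ℂ 0 - FreeAlgebra.ι ℂ 0 * c n' m')
    (heY : e (FreeAlgebra.ι ℂ 1) = 0) {G : (FreeAlgebra ℂ (Fin 2))⟦X⟧⟦X⟧⟦X⟧⟦X⟧}
    (hG : G = C (C X) * ((cOuter * const (FreeAlgebra.ι ℂ 0) -
        const (FreeAlgebra.ι ℂ 0) * cOuter) * cInner) +
        C (C X) * (const (FreeAlgebra.ι ℂ 0) * G) +
        C (C (C X)) * (const (FreeAlgebra.ι ℂ 1) * G))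
    (n m : ℕ) : e (c n m) = coeffs n m n' m' G := by
  have hXs : ∀ (k l : ℕ) φ,
      coeffs (k + 1) l n' m' (C (C X) * φ) = coeffs k l n' m' φ := by
    simp [coeffs, coeff_succ_X_mul, coeff_C_mul]
  have hX0 : ∀ (l : ℕ) φ, coeffs 0 l n' m' (C (C X) * φ) = 0 := by
    simp [coeffs, coeff_C_mul]
  have hYs : ∀ (k l : ℕ) φ,
      coeffs k (l + 1) n' m' (C (C (C X)) * φ) = coeffs k l n' m' φ := by
    simp [coeffs, coeff_succ_X_mul, coeff_C_mul]
  have hY0 : ∀ (k : ℕ) φ, coeffs k 0 n' m' (C (C (C X)) * φ) = 0 := by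
    simp [coeffs, coeff_C_mul]
  refine he.apply_c heX heY (g := fun k l => coeffs k l n' m' G) ?_ ?_ ?_ ?_ n m <;> intros <;>
    conv_lhs => rw [hG]
  all_goals simp only [coeffs_add, hXs, hX0, hYs, hY0, coeffs_const_mul,
    coeffs_commutator_cOuter_mul_cInner, add_zero, zero_add]

theorem C_mem_center {A : Type*} [Ring A] {a : A} (ha : a ∈ Subring.center A) :
    (C a : A⟦X⟧) ∈ Subring.center A⟦X⟧ := by
  rw [Subring.mem_center_iff] at ha ⊢
  intro φ
  ext n
  rw [coeff_mul_C, coeff_C_mul, ha]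

theorem X_mem_center {A : Type*} [Ring A] : (X : A⟦X⟧) ∈ Subring.center A⟦X⟧ :=
  Subring.mem_center_iff.2 fun φ => (commute_X φ).eq

/-- The equality `δ c' - δ' c = [c, c']` for `δ = δ_{n,m}`, `δ' = δ_{n',m'}`. -/
theorem apply_c_sub_apply_c (n m n' m' : ℕ)
    {d e : FreeAlgebra ℂ (Fin 2) →ₗ[ℂ] FreeAlgebra ℂ (Fin 2)}
    (hd : IsDerivation d) (he : IsDerivation e)
    (hdX : d (FreeAlgebra.ι ℂ 0) =
      c n m * FreeAlgebra.ι ℂ 0 - FreeAlgebra.ι ℂ 0 * c n m)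
    (hdY : d (FreeAlgebra.ι ℂ 1) = 0)
    (heX : e (FreeAlgebra.ι ℂ 0) =
      c n' m' * FreeAlgebra.ι ℂ 0 - FreeAlgebra.ι ℂ 0 * c n' m')
    (heY : e (FreeAlgebra.ι ℂ 1) = 0) :
    d (c n' m') - e (c n m) = c n m * c n' m' - c n' m' * c n m := by
  let R := (FreeAlgebra ℂ (Fin 2))⟦X⟧⟦X⟧⟦X⟧⟦X⟧
  let x : Subring.center R := ⟨C (C X), C_mem_center (C_mem_center X_mem_center)⟩
  let y : Subring.center R :=
    ⟨C (C (C X)), C_mem_center (C_mem_center (C_mem_center X_mem_center))⟩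
  let x' : Subring.center R := ⟨X, X_mem_center⟩
  let y' : Subring.center R := ⟨C X, C_mem_center X_mem_center⟩
  have hne : ∀ r : R, (x' - x) • r = 0 → r = 0 := by
    intro r hr
    refine (mul_eq_zero.1 (show (X - C (C X) : R) * r = 0 from hr)).resolve_left fun h => ?_
    simpa [coeff_X, coeff_C] using congrArg (coeff 1) h
  have hl : cInner = 1 + x • (const (FreeAlgebra.ι ℂ 0) * cInner) +
      y • (const (FreeAlgebra.ι ℂ 1) * cInner) := by
    change cInner = 1 + C (C X) * (const (FreeAlgebra.ι ℂ 0) * cInner) +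
      C (C (C X)) * (const (FreeAlgebra.ι ℂ 1) * cInner)
    simpa [cInner, const] using congrArg (C.comp C) cSeries_eq_left
  have hr : cInner = 1 + x • (cInner * const (FreeAlgebra.ι ℂ 0)) +
      y • (cInner * const (FreeAlgebra.ι ℂ 1)) := by
    change cInner = 1 + C (C X) * (cInner * const (FreeAlgebra.ι ℂ 0)) +
      C (C (C X)) * (cInner * const (FreeAlgebra.ι ℂ 1))
    simpa [cInner, const] using congrArg (C.comp C) cSeries_eq_right
  have hl' : cOuter = 1 + x' • (const (FreeAlgebra.ι ℂ 0) * cOuter) +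
      y' • (const (FreeAlgebra.ι ℂ 1) * cOuter) := by
    change cOuter = 1 + X * (const (FreeAlgebra.ι ℂ 0) * cOuter) +
      C X * (const (FreeAlgebra.ι ℂ 1) * cOuter)
    simpa [cOuter, const] using congrArg (map (map (C.comp C))) cSeries_eq_left
  have hr' : cOuter = 1 + x' • (cOuter * const (FreeAlgebra.ι ℂ 0)) +
      y' • (cOuter * const (FreeAlgebra.ι ℂ 1)) := by
    change cOuter = 1 + X * (cOuter * const (FreeAlgebra.ι ℂ 0)) +
      C X * (cOuter * const (FreeAlgebra.ι ℂ 1))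
    simpa [cOuter, const] using congrArg (map (map (C.comp C))) cSeries_eq_right
  have key := congrArg (coeffs n m n' m') (resolvent_identity hne hl hr hl' hr')
  rw [coeffs_sub, coeffs_sub, coeffs_cInner_mul_cOuter, coeffs_cOuter_mul_cInner] at key
  rw [← key]
  congr 1
  · exact apply_c_outer n m hd hdX hdY (smul_resolvent_mul hl' _ _) n' m'
  · exact apply_c_inner n' m' he heX heY (smul_resolvent_mul hl _ _) n m

end GeneratingSeries

/-- The derivations `δ_{n,m}` (for `n ≥ 0`, `m ≥ 1`) of `ℂ⟨X,Y⟩` determined by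
`δ_{n,m}(X) = [c_{n,m}, X]`, `δ_{n,m}(Y) = 0` pairwise commute. -/
theorem delta_derivations_commute
    (n m n' m' : ℕ) (hm : 1 ≤ m) (hm' : 1 ≤ m')
    (d e : FreeAlgebra ℂ (Fin 2) →ₗ[ℂ] FreeAlgebra ℂ (Fin 2))
    (hd : IsDerivation d) (he : IsDerivation e)
    (hdX : d (FreeAlgebra.ι ℂ 0) =
      c n m * FreeAlgebra.ι ℂ 0 - FreeAlgebra.ι ℂ 0 * c n m)
    (hdY : d (FreeAlgebra.ι ℂ 1) = 0)
    (heX : e (FreeAlgebra.ι ℂ 0) =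
      c n' m' * FreeAlgebra.ι ℂ 0 - FreeAlgebra.ι ℂ 0 * c n' m')
    (heY : e (FreeAlgebra.ι ℂ 1) = 0) :
    d.comp e = e.comp d := by
  refine hd.comp_comm he fun i => ?_
  fin_cases i
  · have h := apply_c_sub_apply_c n m n' m' hd he hdX hdY heX heY
    have h' : d (c n' m') = e (c n m) + (c n m * c n' m' - c n' m' * c n m) :=
      sub_eq_iff_eq_add'.1 h
    simp only [Fin.zero_eta, heX, hdX, map_sub, hd _ _, he _ _, h']
    noncomm_ring
  · simp [hdY, heY]
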